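/- Suppose A_1, A_2 are irreducible n×n max-plus matrices with all diagonal entries of A_1 different from -∞, and suppose the product A_2⊗A_1 satisfies (A_2⊗A_1)^{k+d} = (dλ) ⊗ (A_2⊗A_1)^k for all k ≥ k_0 (some real λ, positive integers d, k_0). Then the switched trajectory X(k+1) = A_i ⊗ X(k) (i = 1 for k even, i = 2 for k odd) satisfies X(k + 2d) = (dλ) ⊗ X(k) for all even k ≥ 2k_0, where (dλ) ⊗ X means adding dλ to every entry. -/

import Mathlib

/-- The max-plus carrier `ℝ ∪ {-∞}`. -/
abbrev Re := WithBot ℝ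

/-- Max-plus matrix product: `(A ⊗ B) i j = max_k (A i k + B k j)`. -/
noncomputable def mpMul {n : ℕ} (A B : Matrix (Fin n) (Fin n) Re) :
    Matrix (Fin n) (Fin n) Re :=
  fun i j => Finset.univ.sup fun k => A i k + B k j

/-- Max-plus identity matrix: `0` on the diagonal, `-∞` elsewhere. -/
noncomputable def mpId {n : ℕ} : Matrix (Fin n) (Fin n) Re :=
  fun i j => if i = j then ((0 : ℝ) : Re) else ⊥

/-- Max-plus matrix power. -/
noncomputable def mpPow {n : ℕ} (A : Matrix (Fin n) (Fin n) Re) : ℕ → Matrix (Fin n) (Fin n) Re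
  | 0 => mpId
  | k + 1 => mpMul A (mpPow A k)

/-- Max-plus matrix-vector product. -/
noncomputable def mpMulVec {n : ℕ} (A : Matrix (Fin n) (Fin n) Re) (x : Fin n → Re) :
    Fin n → Re :=
  fun i => Finset.univ.sup fun k => A i k + x k

/-- Irreducibility: for all `i j` there is a path `i = i₁, …, i_k = j` with all
entries `A i_t i_{t+1} ≠ -∞` along it (strong connectivity of the digraph). -/
def MpIrreducible {n : ℕ} (A : Matrix (Fin n) (Fin n) Re) : Prop :=
  ∀ i j : Fin n, Relation.TransGen (fun a b => A a b ≠ ⊥) i j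

/-- `h` is an eigenvector of `A` with eigenvalue `l`: `h` is not identically `-∞`
and `A ⊗ h = l ⊗ h`. -/
def IsEigenpair {n : ℕ} (A : Matrix (Fin n) (Fin n) Re) (l : ℝ) (h : Fin n → Re) : Prop :=
  (∃ i, h i ≠ ⊥) ∧ mpMulVec A h = fun i => ((l : Re) + h i)

/-- `l` is a max-plus eigenvalue of `A`. -/
def IsEigenvalue {n : ℕ} (A : Matrix (Fin n) (Fin n) Re) (l : ℝ) : Prop :=
  ∃ h, IsEigenpair A l h

theorem mp_add_sup {n : ℕ} (a : Re) (f : Fin n → Re) :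
    a + Finset.univ.sup f = Finset.univ.sup fun k => a + f k := by
  refine Finset.comp_sup_eq_sup_comp (fun x => a + x) ?_ ?_
  · intro x y
    exact (add_right_mono (a := a) : Monotone fun x => a + x).map_sup x y
  · simp

theorem mp_sup_add {n : ℕ} (a : Re) (f : Fin n → Re) :
    Finset.univ.sup f + a = Finset.univ.sup fun k => f k + a := by
  rw [add_comm, mp_add_sup]
  simp only [add_comm]

theorem mp_vec_assoc {n : ℕ} (A B : Matrix (Fin n) (Fin n) Re) (x : Fin n → Re) :
    mpMulVec (mpMul A B) x = mpMulVec A (mpMulVec B x) := by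
  funext i
  simp only [mpMulVec, mpMul, mp_add_sup, mp_sup_add]
  rw [Finset.sup_comm]
  simp only [add_assoc]

theorem mp_id_vec {n : ℕ} (x : Fin n → Re) : mpMulVec mpId x = x := by
  funext i
  simp only [mpMulVec, mpId]
  apply le_antisymm
  · refine Finset.sup_le fun k _ => ?_
    split_ifs with h
    · subst h; simp
    · simp
  · refine le_trans ?_ (Finset.le_sup (Finset.mem_univ i))
    simp

theorem mp_traj {n : ℕ} (A₁ A₂ : Matrix (Fin n) (Fin n) Re) (X : ℕ → Fin n → Re)
    (hX : ∀ k, X (k + 1) = mpMulVec (if k % 2 = 0 then A₁ else A₂) (X k)) (m : ℕ) :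
    X (2 * m) = mpMulVec (mpPow (mpMul A₂ A₁) m) (X 0) := by
  induction m with
  | zero => simp [mpPow, mp_id_vec]
  | succ m ih =>
    have e1 := hX (2 * m)
    have e2 := hX (2 * m + 1)
    rw [if_pos (by omega)] at e1
    rw [if_neg (by omega)] at e2
    rw [show 2 * (m + 1) = 2 * m + 1 + 1 by ring, e2, e1, ih, mpPow,
      mp_vec_assoc (mpMul A₂ A₁), mp_vec_assoc A₂ A₁]

theorem stmt12 {n : ℕ} (A₁ A₂ : Matrix (Fin n) (Fin n) Re)
    (h₁ : MpIrreducible A₁) (h₂ : MpIrreducible A₂)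
    (hdiag : ∀ i, A₁ i i ≠ ⊥)
    (lam : ℝ) (d k₀ : ℕ) (hd : 1 ≤ d) (hk₀ : 1 ≤ k₀)
    (hper : ∀ k, k₀ ≤ k →
      mpPow (mpMul A₂ A₁) (k + d) =
        fun i j => (((d : ℝ) * lam : ℝ) : Re) + mpPow (mpMul A₂ A₁) k i j)
    (X : ℕ → Fin n → Re)
    (hX : ∀ k, X (k + 1) = mpMulVec (if k % 2 = 0 then A₁ else A₂) (X k)) :
    ∀ k, k % 2 = 0 → 2 * k₀ ≤ k →
      X (k + 2 * d) = fun i => (((d : ℝ) * lam : ℝ) : Re) + X k i := by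
  intro k hk hle
  obtain ⟨m, rfl⟩ : ∃ m, k = 2 * m := ⟨k / 2, by omega⟩
  rw [show 2 * m + 2 * d = 2 * (m + d) by ring, mp_traj A₁ A₂ X hX, mp_traj A₁ A₂ X hX m,
    hper m (by omega)]
  funext i
  simp only [mpMulVec, mp_add_sup, add_assoc]
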